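/- arXiv:math/0505591 — 2 statements merged into one kernel-verified Lean document; each statement's English description precedes it below -/
import Mathlib

section
/- Let p be a prime. Let σ : ℝ → 𝕋 be a continuous additive character of the real line and let χ : ℚ_p → 𝕋 be a continuous additive character of the p-adic numbers, where 𝕋 is the circle group. If σ(r) = χ(r) for every rational number r (under the canonical embeddings of ℚ into ℝ and into ℚ_p), then both σ and χ are the trivial character. -/
open Filter Topology in
/-- For `1 < a`, the sequence `a ^ n / (1 + a ^ n)` tends to `1` in `ℝ`. -/
theorem tendsto_pow_div_one_add_pow_real {a : ℝ} (ha : 1 < a) :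
    Tendsto (fun n : ℕ => a ^ n / (1 + a ^ n)) atTop (𝓝 1) := by
  have ha0 : 0 < a := one_pos.trans ha
  have h0 : Tendsto (fun n : ℕ => a⁻¹ ^ n) atTop (𝓝 0) :=
    tendsto_pow_atTop_nhds_zero_of_lt_one (by positivity) (inv_lt_one_of_one_lt₀ ha)
  have h1 : Tendsto (fun n : ℕ => (a⁻¹ ^ n + 1)⁻¹) atTop (𝓝 1) := by
    simpa using (h0.add_const 1).inv₀ (by simp)
  refine h1.congr fun n => ?_
  have hn : 0 < a ^ n := pow_pos ha0 n
  rw [inv_pow]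
  field_simp

open Filter Topology in
/-- The sequence `p ^ n / (1 + p ^ n)` tends to `0` in `ℚ_[p]`. -/
theorem tendsto_pow_div_one_add_pow_padic (p : ℕ) [Fact p.Prime] :
    Tendsto (fun n : ℕ => (p : ℚ_[p]) ^ n / (1 + (p : ℚ_[p]) ^ n)) atTop (𝓝 0) := by
  have h0 : Tendsto (fun n : ℕ => (p : ℚ_[p]) ^ n) atTop (𝓝 0) :=
    tendsto_pow_atTop_nhds_zero_of_norm_lt_one Padic.norm_p_lt_one
  simpa [Pi.div_def] using h0.div (h0.const_add 1) (by simp)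

/-- If a continuous character `σ` of `ℝ` and a continuous character `χ` of `ℚ_p` agree on
the canonically embedded rationals, then both are trivial. -/
theorem real_padic_char_agree_on_rat_trivial (p : ℕ) [Fact p.Prime]
    (σ : AddChar ℝ Circle) (hσ : Continuous σ)
    (χ : AddChar ℚ_[p] Circle) (hχ : Continuous χ)
    (h : ∀ r : ℚ, σ (r : ℝ) = χ (r : ℚ_[p])) :
    (∀ x : ℝ, σ x = 1) ∧ (∀ y : ℚ_[p], χ y = 1) := by
  have key (r : ℚ) : σ (r : ℝ) = 1 := by
    have hp : (1 : ℝ) < p := mod_cast (Fact.out : p.Prime).one_lt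
    have hreal := (hσ.tendsto _).comp
      ((tendsto_pow_div_one_add_pow_real hp).const_mul (r : ℝ))
    have hpadic := (hχ.tendsto _).comp
      ((tendsto_pow_div_one_add_pow_padic p).const_mul (r : ℚ_[p]))
    rw [mul_one] at hreal
    rw [mul_zero, AddChar.map_zero_eq_one] at hpadic
    refine tendsto_nhds_unique hreal (hpadic.congr fun n => ?_)
    simpa using (h (r * ((p : ℚ) ^ n / (1 + (p : ℚ) ^ n)))).symm
  constructor
  · exact congrFun (Rat.denseRange_cast.equalizer hσ continuous_const (funext key))
  · exact congrFun ((Padic.denseRange_ratCast p).equalizer hχ continuous_const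
      (funext fun r => (h r).symm.trans (key r)))
end

section
/- Let E be a nonempty compact Hausdorff topological space equipped with a binary operation (e, f) ↦ e·f that is commutative, associative, and idempotent (e·e = e for all e), and separately continuous (for each fixed f, both e ↦ e·f and e ↦ f·e are continuous). Then E contains an absorbing element, i.e. an element m such that m·e = m for every e ∈ E; equivalently, E has a minimal idempotent with respect to the partial order in which e ≤ f if and only if e·f = f. -/
/-- A nonempty compact Hausdorff semitopological semilattice (commutative, associative,
idempotent, separately continuous multiplication) has an absorbing element, i.e. a minimal
idempotent. -/
theorem compact_semilattice_exists_absorbing {E : Type*} [TopologicalSpace E]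
    [CompactSpace E] [T2Space E] [Nonempty E]
    (op : E → E → E)
    (hcomm : ∀ a b, op a b = op b a)
    (hassoc : ∀ a b c, op (op a b) c = op a (op b c))
    (hidem : ∀ a, op a a = a)
    (hcont_left : ∀ a, Continuous (fun b => op a b))
    (hcont_right : ∀ a, Continuous (fun b => op b a)) :
    ∃ m : E, ∀ e : E, op m e = m := by
  have hdir : Directed (· ⊇ ·) fun a => {x | op a x = x} := by
    intro a b
    refine ⟨op a b, fun x (hx : op (op a b) x = x) => ?_, fun x (hx : op (op a b) x = x) => ?_⟩
    · change op a x = x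
      rw [← hx, ← hassoc, ← hassoc, hidem]
    · change op b x = x
      rw [← hx, hcomm a b, ← hassoc, ← hassoc, hidem]
  have hclosed : ∀ a, IsClosed {x | op a x = x} := fun a =>
    isClosed_eq (hcont_left a) continuous_id
  obtain ⟨m, hm⟩ := IsCompact.nonempty_iInter_of_directed_nonempty_isCompact_isClosed _ hdir
    (fun a => ⟨a, hidem a⟩) (fun a => (hclosed a).isCompact) hclosed
  exact ⟨m, fun e => (hcomm m e).trans (Set.mem_iInter.mp hm e)⟩
end
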